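/- arXiv:2401.09612 — 3 statements merged into one kernel-verified Lean document; each statement's English description precedes it below -/
import Mathlib

section
/- For every finite-dimensional linear subspace $E$ of $H$, the set $E\cap\{u\in H : I(u)\ge 0\}$ is bounded in $H$. (Condition (3) of the Ambrosetti–Rabinowitz theorem; note also $I(-u)=I(u)$ for all $u$.) -/
open MeasureTheory Filter Topology

theorem integral_abs_rpow_eq_norm_rpow {Ω : Type*} [MeasurableSpace Ω] {μ : Measure Ω}
    {p : ℝ} (hp : 0 < p) (f : Lp ℝ (ENNReal.ofReal p) μ) :
    ∫ x, |f x| ^ p ∂μ = ‖f‖ ^ p := by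
  have hp' : ENNReal.ofReal p ≠ 0 := by simpa using hp
  have hnonneg : 0 ≤ ∫ x, |f x| ^ p ∂μ := integral_nonneg fun x => by positivity
  rw [Lp.norm_def, (Lp.memLp f).eLpNorm_eq_integral_rpow_norm hp' ENNReal.ofReal_ne_top,
    ENNReal.toReal_ofReal hp.le]
  simp only [Real.norm_eq_abs]
  rw [ENNReal.toReal_ofReal (by positivity), Real.rpow_inv_rpow hnonneg hp.ne']

/-- An injective continuous linear map is bounded below on finite-dimensional subspaces. -/
theorem exists_norm_le_mul_norm_of_finiteDimensional {H F : Type*} [NormedAddCommGroup H]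
    [NormedSpace ℝ H] [NormedAddCommGroup F] [NormedSpace ℝ F] (T : H →L[ℝ] F)
    (hT : Function.Injective T) (E : Submodule ℝ H) [FiniteDimensional ℝ E] :
    ∃ K : ℝ, 0 < K ∧ ∀ u ∈ E, ‖u‖ ≤ K * ‖T u‖ := by
  have hker : LinearMap.ker ((T : H →ₗ[ℝ] F) ∘ₗ E.subtype) = ⊥ :=
    LinearMap.ker_eq_bot.2 (hT.comp Subtype.val_injective)
  obtain ⟨K, hK, hanti⟩ := LinearMap.exists_antilipschitzWith _ hker
  refine ⟨K, hK, fun u hu => ?_⟩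
  simpa using hanti.le_mul_dist ⟨u, hu⟩ 0

/-- A superquadratic power dominates a quadratic term away from a bounded set. -/
theorem le_rpow_of_rpow_le_mul_sq {q C t : ℝ} (hq : 1 < q) (hC : 0 ≤ C) (ht : 0 ≤ t)
    (h : t ^ (q + 1) ≤ C * t ^ 2) : t ≤ C ^ (q - 1)⁻¹ := by
  rcases ht.eq_or_lt with rfl | ht
  · positivity
  rw [show q + 1 = (q - 1) + (2 : ℕ) by push_cast; ring, Real.rpow_add_natCast ht.ne'] at h
  have h' : t ^ (q - 1) ≤ C := le_of_mul_le_mul_right h (by positivity)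
  exact (Real.le_rpow_inv_iff_of_pos ht.le hC (by linarith)).2 h'

/-- The functional `I(u) = ½B(u,u) - (1/(q+1)) ∫ |Tu|^{q+1} dμ` is even,
and for every finite-dimensional subspace `E` of `H` the set `E ∩ {I ≥ 0}` is bounded. -/
theorem even_and_bounded_on_finite_dimensional_subspaces
    {H : Type*} [NormedAddCommGroup H] [InnerProductSpace ℝ H] [CompleteSpace H]
    {Ω : Type*} [MeasurableSpace Ω] (μ : Measure Ω)
    (q : ℝ) (hq : 1 < q) [Fact (1 ≤ ENNReal.ofReal (q + 1))]
    (T : H →L[ℝ] Lp ℝ (ENNReal.ofReal (q + 1)) μ)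
    (hTcomp : IsCompactOperator T) (hTinj : Function.Injective T)
    (B : H →L[ℝ] H →L[ℝ] ℝ) (hBsymm : ∀ u v : H, B u v = B v u)
    (c0 : ℝ) (hc0 : 0 < c0) (hBcoer : ∀ u : H, c0 * ‖u‖ ^ 2 ≤ B u u)
    (I : H → ℝ)
    (hI : ∀ u : H, I u = (1 / 2) * B u u - (1 / (q + 1)) * ∫ x, |(T u) x| ^ (q + 1) ∂μ) :
    (∀ u : H, I (-u) = I u) ∧
    ∀ E : Submodule ℝ H, FiniteDimensional ℝ E →
      Bornology.IsBounded {u : H | u ∈ E ∧ 0 ≤ I u} := by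
  have hp : 0 < q + 1 := by linarith
  simp only [integral_abs_rpow_eq_norm_rpow hp] at hI
  refine ⟨fun u => by simp [hI], fun E hE => ?_⟩
  obtain ⟨K, hK, hbound⟩ := exists_norm_le_mul_norm_of_finiteDimensional T hTinj E
  refine isBounded_iff_forall_norm_le.2
    ⟨(K ^ (q + 1) * ((q + 1) / 2 * ‖B‖)) ^ (q - 1)⁻¹, fun u ⟨huE, hIu⟩ => ?_⟩
  refine le_rpow_of_rpow_le_mul_sq hq (by positivity) (norm_nonneg u) ?_
  have hBu : B u u ≤ ‖B‖ * ‖u‖ ^ 2 := by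
    have := (le_abs_self _).trans (B.le_opNorm₂ u u)
    rwa [mul_assoc, ← sq] at this
  have hTu : ‖T u‖ ^ (q + 1) ≤ (q + 1) / 2 * ‖B‖ * ‖u‖ ^ 2 := by
    rw [hI] at hIu
    calc ‖T u‖ ^ (q + 1) = (q + 1) * (1 / (q + 1) * ‖T u‖ ^ (q + 1)) := by field_simp
      _ ≤ (q + 1) * (1 / 2 * (‖B‖ * ‖u‖ ^ 2)) :=
        mul_le_mul_of_nonneg_left (by linarith) hp.le
      _ = (q + 1) / 2 * ‖B‖ * ‖u‖ ^ 2 := by ring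
  calc ‖u‖ ^ (q + 1) ≤ (K * ‖T u‖) ^ (q + 1) := by gcongr; exact hbound u huE
    _ = K ^ (q + 1) * ‖T u‖ ^ (q + 1) := Real.mul_rpow hK.le (norm_nonneg _)
    _ ≤ K ^ (q + 1) * ((q + 1) / 2 * ‖B‖ * ‖u‖ ^ 2) := by gcongr
    _ = K ^ (q + 1) * ((q + 1) / 2 * ‖B‖) * ‖u‖ ^ 2 := by ring
end

section
/- The sequence $d_m=\inf\{B(u,u)^{1/2} : u\in N\cap E_m^{\perp}\}$ is non-decreasing and tends to $+\infty$: for every $d>0$ there exists $m_0$ such that for all $m\ge m_0$, every $u\in N\cap E_m^{\perp}$ satisfies $B(u,u)^{1/2}>d$. -/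
open MeasureTheory Filter Topology

/-- The `p`-th power of the norm in `L^p`, `0 < p < ∞`, is the integral of `|f|^p`. -/
theorem Lp.norm_rpow_eq_integral {Ω : Type*} [MeasurableSpace Ω] {μ : Measure Ω} {p : ℝ}
    (hp : 0 < p) (f : Lp ℝ (ENNReal.ofReal p) μ) :
    ‖f‖ ^ p = ∫ x, |f x| ^ p ∂μ := by
  have h0 : ENNReal.ofReal p ≠ 0 := by simpa using hp
  have hI : 0 ≤ ∫ x, |f x| ^ p ∂μ := integral_nonneg fun x => by positivity
  rw [Lp.norm_def, (Lp.memLp f).eLpNorm_eq_integral_rpow_norm h0 ENNReal.ofReal_ne_top,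
    ENNReal.toReal_ofReal hp.le]
  simp only [Real.norm_eq_abs]
  rw [ENNReal.toReal_ofReal (by positivity), Real.rpow_inv_rpow hI hp.ne']

/-- A bounded sequence whose terms are orthogonal to longer and longer initial segments of a
Hilbert basis converges weakly to zero. -/
theorem HilbertBasis.tendsto_dual_zero {H : Type*} [NormedAddCommGroup H] [InnerProductSpace ℝ H]
    [CompleteSpace H] (e : HilbertBasis ℕ ℝ H) {m : ℕ → ℕ} (hm : Tendsto m atTop atTop)
    {u : ℕ → H} {R : ℝ} (hR : ∀ k, ‖u k‖ ≤ R) (hu : ∀ k, ∀ i < m k, inner ℝ (e i) (u k) = 0)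
    (f : H →L[ℝ] ℝ) : Tendsto (fun k => f (u k)) atTop (𝓝 0) := by
  set h : H := (InnerProductSpace.toDual ℝ H).symm f
  have hf (k : ℕ) : f (u k) = inner ℝ h (u k) :=
    (InnerProductSpace.toDual_symm_apply (x := u k) (y := f)).symm
  have hs : Tendsto (fun n => ∑ i ∈ Finset.range n, e.repr h i • e i) atTop (𝓝 h) :=
    (e.hasSum_repr h).tendsto_sum_nat
  have hz : Tendsto (fun k => ‖h - ∑ i ∈ Finset.range (m k), e.repr h i • e i‖ * R)
      atTop (𝓝 0) := by
    simpa using ((tendsto_const_nhds (x := h)).sub (hs.comp hm)).norm.mul_const R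
  refine squeeze_zero_norm (fun k => ?_) hz
  have hk : f (u k) = inner ℝ (h - ∑ i ∈ Finset.range (m k), e.repr h i • e i) (u k) := by
    rw [hf, inner_sub_left, sum_inner, Finset.sum_eq_zero, sub_zero]
    intro i hi
    rw [inner_smul_left, hu k i (Finset.mem_range.1 hi), mul_zero]
  rw [hk]
  exact (norm_inner_le_norm _ _).trans (mul_le_mul_of_nonneg_left (hR k) (norm_nonneg _))

/-- A compact operator maps some subsequence of a bounded weakly null sequence to a norm null
sequence. -/
theorem IsCompactOperator.exists_subseq_tendsto_zero {H Y : Type*} [NormedAddCommGroup H]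
    [NormedSpace ℝ H] [NormedAddCommGroup Y] [NormedSpace ℝ Y] {T : H →L[ℝ] Y}
    (hT : IsCompactOperator T) {u : ℕ → H} {R : ℝ} (hR : ∀ k, ‖u k‖ ≤ R)
    (hu : ∀ f : H →L[ℝ] ℝ, Tendsto (fun k => f (u k)) atTop (𝓝 0)) :
    ∃ φ : ℕ → ℕ, StrictMono φ ∧ Tendsto (fun k => T (u (φ k))) atTop (𝓝 0) := by
  obtain ⟨y, -, φ, hφ, hy⟩ := (hT.isCompact_closure_image_closedBall R).tendsto_subseq
    (x := fun k => T (u k))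
    fun k => subset_closure ⟨u k, by simpa using hR k, rfl⟩
  have hy0 : y = 0 := by
    refine SeparatingDual.eq_zero_of_forall_dual_eq_zero (R := ℝ) fun g => ?_
    exact tendsto_nhds_unique ((g.continuous.tendsto y).comp hy)
      ((hu (g.comp T)).comp hφ.tendsto_atTop)
  exact ⟨φ, hφ, hy0 ▸ hy⟩

/-- Positive numbers `a`, `b` admit a positive `t` balancing `a t²` against `b t ^ (q + 1)`. -/
theorem exists_pos_mul_sq_eq_mul_rpow {a b q : ℝ} (ha : 0 < a) (hb : 0 < b) (hq : 1 < q) :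
    ∃ t : ℝ, 0 < t ∧ a * t ^ 2 = b * t ^ (q + 1) := by
  have hab : 0 < a / b := by positivity
  refine ⟨(a / b) ^ (q - 1)⁻¹, by positivity, ?_⟩
  set t : ℝ := (a / b) ^ (q - 1)⁻¹ with ht
  have ht0 : 0 < t := by positivity
  have h1 : t ^ (q - 1) = a / b := Real.rpow_inv_rpow hab.le (by linarith)
  have h2 : t ^ (q + 1) = t ^ (q - 1) * t ^ 2 := by
    rw [← Real.rpow_natCast t 2, ← Real.rpow_add ht0]
    congr 1
    push_cast
    ring
  rw [h2, h1]
  field_simp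

/-- With `E_m = span(e_1,…,e_m)` for a Hilbert basis `(e_i)` of `H` and
`d_m = inf{B(u,u)^{1/2} : u ∈ N ∩ E_m^⊥}`, the sequence `(d_m)` is non-decreasing and
tends to `+∞`: for every `d > 0` there is `m₀` with `B(u,u)^{1/2} > d` for all `m ≥ m₀`
and all `u ∈ N ∩ E_m^⊥`. -/
theorem nehari_infima_tend_to_infinity
    {H : Type*} [NormedAddCommGroup H] [InnerProductSpace ℝ H] [CompleteSpace H]
    {Ω : Type*} [MeasurableSpace Ω] (μ : Measure Ω)
    (q : ℝ) (hq : 1 < q) [Fact (1 ≤ ENNReal.ofReal (q + 1))]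
    (T : H →L[ℝ] Lp ℝ (ENNReal.ofReal (q + 1)) μ)
    (hTcomp : IsCompactOperator T) (hTinj : Function.Injective T)
    (B : H →L[ℝ] H →L[ℝ] ℝ) (hBsymm : ∀ u v : H, B u v = B v u)
    (c0 : ℝ) (hc0 : 0 < c0) (hBcoer : ∀ u : H, c0 * ‖u‖ ^ 2 ≤ B u u)
    (N : Set H)
    (hN : N = {u : H | u ≠ 0 ∧
      (1 / 2) * B u u = (1 / (q + 1)) * ∫ x, |(T u) x| ^ (q + 1) ∂μ})
    (e : HilbertBasis ℕ ℝ H)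
    (E : ℕ → Submodule ℝ H)
    (hE : ∀ m : ℕ, E m = Submodule.span ℝ (e '' {i : ℕ | i < m}))
    (d : ℕ → ℝ)
    (hd : ∀ m : ℕ, d m = sInf ((fun u => Real.sqrt (B u u)) '' (N ∩ ((E m)ᗮ : Set H)))) :
    Monotone d ∧
    ∀ c : ℝ, 0 < c → ∃ m₀ : ℕ, ∀ m ≥ m₀,
      ∀ u ∈ N ∩ ((E m)ᗮ : Set H), c < Real.sqrt (B u u) := by
  have hp : 0 < q + 1 := by linarith
  have hmem (u : H) : u ∈ N ↔ u ≠ 0 ∧ (1 / 2) * B u u = (1 / (q + 1)) * ‖T u‖ ^ (q + 1) := by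
    rw [hN, Set.mem_ofPred_eq, Lp.norm_rpow_eq_integral hp]
  have hBpos (u : H) (hu : u ≠ 0) : 0 < B u u :=
    lt_of_lt_of_le (by positivity) (hBcoer u)
  have horth (m : ℕ) (u : H) : u ∈ (E m)ᗮ ↔ ∀ i < m, inner ℝ (e i) u = 0 := by
    rw [hE, Submodule.mem_orthogonal]
    refine ⟨fun h i hi => h _ (Submodule.subset_span ⟨i, hi, rfl⟩), fun h v hv => ?_⟩
    induction hv using Submodule.span_induction with
    | mem v hv =>
      obtain ⟨i, hi, rfl⟩ := hv
      exact h i hi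
    | zero => exact inner_zero_left u
    | add v w _ _ hv hw => rw [inner_add_left, hv, hw, add_zero]
    | smul r v _ hv => rw [inner_smul_left, hv, mul_zero]
  refine ⟨?_, ?_⟩
  · intro m n hmn
    rw [hd, hd]
    refine csInf_le_csInf ⟨0, ?_⟩ (Set.Nonempty.image _ ?_) (Set.image_mono ?_)
    · rintro _ ⟨u, -, rfl⟩
      exact Real.sqrt_nonneg _
    · have hen : e n ≠ 0 := e.orthonormal.ne_zero n
      have hTen : 0 < ‖T (e n)‖ := norm_pos_iff.2 ((map_ne_zero_iff T hTinj).2 hen)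
      obtain ⟨t, ht, hteq⟩ := exists_pos_mul_sq_eq_mul_rpow
        (a := (1 / 2) * B (e n) (e n)) (b := (1 / (q + 1)) * ‖T (e n)‖ ^ (q + 1))
        (by have := hBpos _ hen; positivity) (by positivity) hq
      refine ⟨t • e n, (hmem _).2 ⟨smul_ne_zero ht.ne' hen, ?_⟩, (horth _ _).2 fun i hi => ?_⟩
      · rw [map_smul, map_smul, map_smul, norm_smul, Real.norm_of_nonneg ht.le,
          Real.mul_rpow ht.le hTen.le]
        simp only [smul_apply, smul_eq_mul]
        linear_combination hteq
      · rw [inner_smul_right, e.orthonormal.2 hi.ne, mul_zero]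
    · rintro u ⟨huN, hu⟩
      exact ⟨huN, (horth _ _).2 fun i hi => (horth _ _).1 hu i (hi.trans_le hmn)⟩
  · intro c hc
    by_contra! hcon
    choose m hm u hu huc using hcon
    have hB (k : ℕ) : B (u k) (u k) ≤ c ^ 2 := (Real.sqrt_le_left hc.le).1 (huc k)
    have hR (k : ℕ) : ‖u k‖ ≤ Real.sqrt (c ^ 2 / c0) := by
      refine Real.le_sqrt_of_sq_le ((le_div_iff₀ hc0).2 ?_)
      linarith [hBcoer (u k), hB k]
    obtain ⟨φ, -, hT0⟩ := hTcomp.exists_subseq_tendsto_zero hR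
      (e.tendsto_dual_zero (tendsto_atTop_mono hm tendsto_id) hR fun k => (horth _ _).1 (hu k).2)
    have hcoer (k : ℕ) : c0 * ‖u k‖ ^ 2 ≤ 2 / (q + 1) * ‖T (u k)‖ ^ (q + 1) := by
      have h := ((hmem _).1 (hu k).1).2
      have h' : B (u k) (u k) = 2 / (q + 1) * ‖T (u k)‖ ^ (q + 1) := by
        linear_combination 2 * h
      exact h' ▸ hBcoer (u k)
    have hlow (k : ℕ) : c0 ≤ 2 / (q + 1) * ‖T‖ ^ 2 * ‖T (u k)‖ ^ (q - 1) := by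
      have hu0 : 0 < ‖u k‖ := norm_pos_iff.2 ((hmem _).1 (hu k).1).1
      have hTu : 0 < ‖T (u k)‖ :=
        norm_pos_iff.2 ((map_ne_zero_iff T hTinj).2 ((hmem _).1 (hu k).1).1)
      have hsplit : ‖T (u k)‖ ^ (q + 1) = ‖T (u k)‖ ^ (q - 1) * ‖T (u k)‖ ^ 2 := by
        rw [← Real.rpow_natCast _ 2, ← Real.rpow_add hTu]
        congr 1
        push_cast
        ring
      refine le_of_mul_le_mul_right ?_ (pow_pos hu0 2)
      calc c0 * ‖u k‖ ^ 2 ≤ 2 / (q + 1) * (‖T (u k)‖ ^ (q - 1) * ‖T (u k)‖ ^ 2) :=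
            hsplit ▸ hcoer k
        _ ≤ 2 / (q + 1) * (‖T (u k)‖ ^ (q - 1) * (‖T‖ * ‖u k‖) ^ 2) := by
            gcongr
            exact T.le_opNorm _
        _ = _ := by ring
    have hlim : Tendsto (fun k => 2 / (q + 1) * ‖T‖ ^ 2 * ‖T (u (φ k))‖ ^ (q - 1)) atTop
        (𝓝 0) := by
      have h := (hT0.norm.rpow_const (p := q - 1) (Or.inr (by linarith))).const_mul
        (2 / (q + 1) * ‖T‖ ^ 2)
      simpa [Real.zero_rpow (sub_pos.2 hq).ne'] using h
    exact hc0.not_ge (ge_of_tendsto' hlim fun k => hlow (φ k))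
end

section
/- There exists a constant $k>0$ such that for every $m\ge 1$ there is an odd homeomorphism $h_m:H\to H$ (in fact a linear bijection) with the following two properties: (i) $I(h_m(u))\ge 0$ for every $u\in H$ with $\|u\|_H\le 1$; (ii) $I(h_m(u))\ge k\,d_m^2$ for every $u\in E_m^{\perp}$ with $\|u\|_H=1$. -/
open MeasureTheory Filter Topology

theorem exists_pos_mul_rpow_le {A κ r : ℝ} (hA : 0 ≤ A) (hκ : 0 < κ) (hr : 0 < r) :
    ∃ ρ > 0, A * ρ ^ r ≤ κ := by
  refine ⟨(κ / (A + 1)) ^ r⁻¹, by positivity, ?_⟩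
  rw [Real.rpow_inv_rpow (by positivity) hr.ne', mul_div_assoc', div_le_iff₀ (by positivity)]
  nlinarith

theorem add_rpow_le_two_rpow_mul {a b p : ℝ} (ha : 0 ≤ a) (hb : 0 ≤ b) (hp : 0 ≤ p) :
    (a + b) ^ p ≤ 2 ^ p * (a ^ p + b ^ p) := by
  wlog hab : a ≤ b generalizing a b
  · rw [add_comm a, add_comm (a ^ p)]
    exact this hb ha (le_of_not_ge hab)
  calc (a + b) ^ p ≤ (2 * b) ^ p := by gcongr; linarith
    _ = 2 ^ p * b ^ p := Real.mul_rpow (by norm_num) hb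
    _ ≤ 2 ^ p * (a ^ p + b ^ p) := by
      gcongr
      linarith [Real.rpow_nonneg ha p]

/-- If `d` bounds from below the energy norm `t √b` at every `t > 0` for which the ray meets the
Nehari set, then the potential part `f` is controlled by the quadratic part `b`. -/
theorem rpow_mul_le_of_forall_nehari {b f d r : ℝ} (hb : 0 < b) (hf : 0 ≤ f) (hd : 0 ≤ d)
    (hr : 0 < r) (h : ∀ t > 0, 1 / 2 * (t ^ 2 * b) = t ^ (r + 2) * f → d ≤ t * √b) :
    d ^ r * f ≤ 1 / 2 * b * √b ^ r := by
  rcases hf.eq_or_lt with rfl | hf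
  · rw [mul_zero]
    positivity
  set t := (b / (2 * f)) ^ r⁻¹ with ht
  have ht0 : 0 < t := by positivity
  have htr : t ^ r = b / (2 * f) := Real.rpow_inv_rpow (by positivity) hr.ne'
  have hdt : d ≤ t * √b := by
    refine h t ht0 ?_
    rw [Real.rpow_add ht0, htr, Real.rpow_two]
    field_simp
  calc d ^ r * f ≤ (t * √b) ^ r * f := by gcongr
    _ = 1 / 2 * b * √b ^ r := by
      rw [Real.mul_rpow ht0.le (Real.sqrt_nonneg b), htr]
      field_simp

/-- Scaling by `t` on a complemented subspace and by `s` on its orthogonal complement. -/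
theorem exists_continuousLinearEquiv_scaling {H : Type*} [NormedAddCommGroup H]
    [InnerProductSpace ℝ H] (K : Submodule ℝ H) [K.HasOrthogonalProjection] {t s : ℝ}
    (ht : t ≠ 0) (hs : s ≠ 0) :
    ∃ h : H ≃L[ℝ] H, ∀ u, h u = t • K.starProjection u + s • (u - K.starProjection u) := by
  have key (t s : ℝ) (ht : t ≠ 0) (hs : s ≠ 0) (u : H) :
      t⁻¹ • K.starProjection (t • K.starProjection u + s • (u - K.starProjection u)) +
        s⁻¹ • ((t • K.starProjection u + s • (u - K.starProjection u)) -
          K.starProjection (t • K.starProjection u + s • (u - K.starProjection u))) = u := by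
    have hP : K.starProjection (K.starProjection u) = K.starProjection u :=
      K.starProjection_eq_self_iff.2 (K.starProjection_apply_mem u)
    simp [hP, smul_smul, ht, hs]
  let f (t s : ℝ) : H →L[ℝ] H :=
    t • K.starProjection + s • (ContinuousLinearMap.id ℝ H - K.starProjection)
  refine ⟨.equivOfInverse (f t s) (f t⁻¹ s⁻¹) (fun u => key t s ht hs u) (fun u => ?_),
    fun u => rfl⟩
  simpa [f] using key t⁻¹ s⁻¹ (inv_ne_zero ht) (inv_ne_zero hs) u

/-- A functional whose potential part is small compared with the quadratic part along each of two
orthogonal vectors is coercive on their sum. -/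
theorem quarter_mul_sq_le_of_orthogonal {H : Type*} [NormedAddCommGroup H]
    [InnerProductSpace ℝ H] {F : Type*} [NormedAddCommGroup F] [NormedSpace ℝ F]
    (T : H →L[ℝ] F) {p : ℝ} (hp : 0 < p) (B : H →L[ℝ] H →L[ℝ] ℝ) {c : ℝ}
    (hB : ∀ u : H, c * ‖u‖ ^ 2 ≤ B u u) {a b : H} (hab : inner ℝ a b = 0)
    (ha : 1 / p * ‖T a‖ ^ p ≤ c / 4 / 2 ^ p * ‖a‖ ^ 2)
    (hb : 1 / p * ‖T b‖ ^ p ≤ c / 4 / 2 ^ p * ‖b‖ ^ 2) :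
    c / 4 * ‖a + b‖ ^ 2 ≤ 1 / 2 * B (a + b) (a + b) - 1 / p * ‖T (a + b)‖ ^ p := by
  have hnorm : ‖a + b‖ ^ 2 = ‖a‖ ^ 2 + ‖b‖ ^ 2 := by
    simpa [sq] using norm_add_sq_eq_norm_sq_add_norm_sq_real hab
  have hF : 1 / p * ‖T (a + b)‖ ^ p ≤ c / 4 * ‖a + b‖ ^ 2 :=
    calc 1 / p * ‖T (a + b)‖ ^ p ≤ 1 / p * (‖T a‖ + ‖T b‖) ^ p := by
          rw [map_add]
          gcongr
          exact norm_add_le _ _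
      _ ≤ 1 / p * (2 ^ p * (‖T a‖ ^ p + ‖T b‖ ^ p)) := by
          gcongr
          exact add_rpow_le_two_rpow_mul (norm_nonneg _) (norm_nonneg _) hp.le
      _ = 2 ^ p * (1 / p * ‖T a‖ ^ p + 1 / p * ‖T b‖ ^ p) := by ring
      _ ≤ 2 ^ p * (c / 4 / 2 ^ p * ‖a‖ ^ 2 + c / 4 / 2 ^ p * ‖b‖ ^ 2) := by gcongr
      _ = c / 4 * ‖a + b‖ ^ 2 := by
          rw [hnorm]
          have : (2 : ℝ) ^ p ≠ 0 := by positivity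
          field_simp
  linarith [hB (a + b)]

/-- (Lemma 3.1 of the paper.) There is `k > 0` such that for every `m ≥ 1`
there is an odd homeomorphism (in fact a continuous linear bijection) `h_m : H → H` with
`I(h_m(u)) ≥ 0` on the closed unit ball and `I(h_m(u)) ≥ k d_m²` for every `u ∈ E_m^⊥` with
`‖u‖ = 1`. -/
theorem competitor_homeomorphisms_exist
    {H : Type*} [NormedAddCommGroup H] [InnerProductSpace ℝ H] [CompleteSpace H]
    {Ω : Type*} [MeasurableSpace Ω] (μ : Measure Ω)
    (q : ℝ) (hq : 1 < q) [Fact (1 ≤ ENNReal.ofReal (q + 1))]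
    (T : H →L[ℝ] Lp ℝ (ENNReal.ofReal (q + 1)) μ)
    (hTcomp : IsCompactOperator T) (hTinj : Function.Injective T)
    (B : H →L[ℝ] H →L[ℝ] ℝ) (hBsymm : ∀ u v : H, B u v = B v u)
    (c0 : ℝ) (hc0 : 0 < c0) (hBcoer : ∀ u : H, c0 * ‖u‖ ^ 2 ≤ B u u)
    (I : H → ℝ)
    (hI : ∀ u : H, I u = (1 / 2) * B u u - (1 / (q + 1)) * ∫ x, |(T u) x| ^ (q + 1) ∂μ)
    (N : Set H)
    (hN : N = {u : H | u ≠ 0 ∧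
      (1 / 2) * B u u = (1 / (q + 1)) * ∫ x, |(T u) x| ^ (q + 1) ∂μ})
    (e : HilbertBasis ℕ ℝ H)
    (E : ℕ → Submodule ℝ H)
    (hE : ∀ m : ℕ, E m = Submodule.span ℝ (e '' {i : ℕ | i < m}))
    (d : ℕ → ℝ)
    (hd : ∀ m : ℕ, d m = sInf ((fun u => Real.sqrt (B u u)) '' (N ∩ ((E m)ᗮ : Set H)))) :
    ∃ k > (0 : ℝ), ∀ m : ℕ, 1 ≤ m → ∃ h : H ≃L[ℝ] H,
      (∀ u : H, ‖u‖ ≤ 1 → 0 ≤ I (h u)) ∧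
      (∀ u ∈ ((E m)ᗮ : Set H), ‖u‖ = 1 → k * (d m) ^ 2 ≤ I (h u)) := by
  have hr : 0 < q - 1 := sub_pos.2 hq
  have hp : 0 < q + 1 := by linarith
  have hsplit {x : ℝ} (hx : 0 ≤ x) : x ^ (q + 1) = x ^ 2 * x ^ (q - 1) := by
    rw [← Real.rpow_two, ← Real.rpow_add_of_nonneg hx (by norm_num) hr.le]
    congr 1
    ring
  simp only [integral_abs_rpow_eq_norm_rpow hp] at hI hN
  have hκ : 0 < c0 / 4 / 2 ^ (q + 1) := by positivity
  obtain ⟨ρ, hρ, hAρ⟩ := exists_pos_mul_rpow_le (A := 1 / 2 * ‖B‖ * √‖B‖ ^ (q - 1))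
    (by positivity) hκ hr
  obtain ⟨ε, hε, hAε⟩ := exists_pos_mul_rpow_le (A := 1 / (q + 1) * ‖T‖ ^ (q + 1))
    (by positivity) hκ hr
  have hsmall (b : H) (hb : ‖b‖ ≤ ε) :
      1 / (q + 1) * ‖T b‖ ^ (q + 1) ≤ c0 / 4 / 2 ^ (q + 1) * ‖b‖ ^ 2 :=
    calc 1 / (q + 1) * ‖T b‖ ^ (q + 1) ≤ 1 / (q + 1) * (‖T‖ * ‖b‖) ^ (q + 1) := by
          gcongr
          exact T.le_opNorm b
      _ = 1 / (q + 1) * ‖T‖ ^ (q + 1) * ‖b‖ ^ (q - 1) * ‖b‖ ^ 2 := by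
          rw [Real.mul_rpow (norm_nonneg _) (norm_nonneg _), hsplit (norm_nonneg b)]
          ring
      _ ≤ 1 / (q + 1) * ‖T‖ ^ (q + 1) * ε ^ (q - 1) * ‖b‖ ^ 2 := by gcongr
      _ ≤ c0 / 4 / 2 ^ (q + 1) * ‖b‖ ^ 2 := by gcongr
  refine ⟨c0 / 4 * ρ ^ 2, by positivity, fun m _ => ?_⟩
  have hd0 : 0 ≤ d m := by
    rw [hd]
    refine Real.sInf_nonneg ?_
    rintro _ ⟨u, -, rfl⟩
    exact Real.sqrt_nonneg _
  have hnehari (a : H) (ha : a ∈ (E m)ᗮ) (hρa : ‖a‖ ≤ ρ * d m) (hdm : 0 < d m) :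
      1 / (q + 1) * ‖T a‖ ^ (q + 1) ≤ c0 / 4 / 2 ^ (q + 1) * ‖a‖ ^ 2 := by
    rcases eq_or_ne a 0 with rfl | ha0
    · simp [Real.zero_rpow hp.ne']
    have hna : 0 < ‖a‖ := norm_pos_iff.2 ha0
    have hBa : 0 < B a a := lt_of_lt_of_le (by positivity) (hBcoer a)
    have hBle : B a a ≤ ‖B‖ * ‖a‖ ^ 2 := by
      calc B a a ≤ ‖B a a‖ := le_abs_self _
        _ ≤ ‖B‖ * ‖a‖ * ‖a‖ := B.le_opNorm₂ a a
        _ = ‖B‖ * ‖a‖ ^ 2 := by ring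
    have hsqrt : √(B a a) ≤ √‖B‖ * ‖a‖ := by
      refine (Real.sqrt_le_sqrt hBle).trans_eq ?_
      rw [Real.sqrt_mul' _ (sq_nonneg _), Real.sqrt_sq hna.le]
    have hray := rpow_mul_le_of_forall_nehari (f := 1 / (q + 1) * ‖T a‖ ^ (q + 1)) hBa
      (by positivity) hd0 hr fun t ht heq => by
        have hBt : B (t • a) (t • a) = t ^ 2 * B a a := by
          simp only [map_smul, smul_apply, smul_eq_mul]
          ring
        have hmem : t • a ∈ N := by
          rw [hN]
          refine ⟨smul_ne_zero ht.ne' ha0, ?_⟩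
          rw [hBt, heq, map_smul, norm_smul, Real.norm_of_nonneg ht.le,
            Real.mul_rpow ht.le (norm_nonneg _), show q - 1 + 2 = q + 1 by ring]
          ring
        have hbdd : BddBelow ((fun u => √(B u u)) '' (N ∩ ((E m)ᗮ : Set H))) := by
          refine ⟨0, ?_⟩
          rintro _ ⟨u, -, rfl⟩
          exact Real.sqrt_nonneg _
        calc d m ≤ √(B (t • a) (t • a)) := by
              rw [hd]
              exact csInf_le hbdd ⟨t • a, ⟨hmem, Submodule.smul_mem _ t ha⟩, rfl⟩
          _ = t * √(B a a) := by rw [hBt, Real.sqrt_mul (sq_nonneg t), Real.sqrt_sq ht.le]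
    have hdr : 0 < d m ^ (q - 1) := by positivity
    refine le_of_mul_le_mul_left (hray.trans ?_) hdr
    calc 1 / 2 * B a a * √(B a a) ^ (q - 1)
        ≤ 1 / 2 * (‖B‖ * ‖a‖ ^ 2) * (√‖B‖ * (ρ * d m)) ^ (q - 1) := by
          gcongr
          exact hsqrt.trans (by gcongr)
      _ = d m ^ (q - 1) * ((1 / 2 * ‖B‖ * √‖B‖ ^ (q - 1) * ρ ^ (q - 1)) * ‖a‖ ^ 2) := by
          rw [Real.mul_rpow (Real.sqrt_nonneg _) (by positivity), Real.mul_rpow hρ.le hd0]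
          ring
      _ ≤ d m ^ (q - 1) * (c0 / 4 / 2 ^ (q + 1) * ‖a‖ ^ 2) := by gcongr
  obtain ⟨t, ht, hdt, htsmall⟩ : ∃ t > 0, ρ * d m ≤ t ∧ ∀ a ∈ (E m)ᗮ, ‖a‖ ≤ t →
      1 / (q + 1) * ‖T a‖ ^ (q + 1) ≤ c0 / 4 / 2 ^ (q + 1) * ‖a‖ ^ 2 := by
    rcases hd0.eq_or_lt with hdm | hdm
    · exact ⟨ε, hε, by rw [← hdm, mul_zero]; exact hε.le, fun a _ => hsmall a⟩
    · exact ⟨ρ * d m, by positivity, le_rfl, fun a ha hρa => hnehari a ha hρa hdm⟩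
  set P := ((E m)ᗮ).starProjection
  obtain ⟨h, hh⟩ := exists_continuousLinearEquiv_scaling (E m)ᗮ ht.ne' hε.ne'
  have hcoer (u : H) (hu : ‖u‖ ≤ 1) : c0 / 4 * ‖h u‖ ^ 2 ≤ I (h u) := by
    have hPmem : P u ∈ (E m)ᗮ := Submodule.starProjection_apply_mem _ u
    have horth : inner ℝ (P u) (u - P u) = 0 :=
      Submodule.inner_right_of_mem_orthogonal hPmem
        (Submodule.sub_starProjection_mem_orthogonal u)
    have hpyth : ‖u‖ ^ 2 = ‖P u‖ ^ 2 + ‖u - P u‖ ^ 2 := by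
      simpa [sq] using norm_add_sq_eq_norm_sq_add_norm_sq_real horth
    have hP1 : ‖P u‖ ≤ 1 := by nlinarith [norm_nonneg u, sq_nonneg ‖u - P u‖]
    have hQ1 : ‖u - P u‖ ≤ 1 := by nlinarith [norm_nonneg u, sq_nonneg ‖P u‖]
    rw [hI, hh]
    refine quarter_mul_sq_le_of_orthogonal T hp B hBcoer ?_ (htsmall _ ?_ ?_) (hsmall _ ?_)
    · rw [inner_smul_left, inner_smul_right, horth, mul_zero, mul_zero]
    · exact Submodule.smul_mem _ t hPmem
    · rw [norm_smul, Real.norm_of_nonneg ht.le]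
      exact mul_le_of_le_one_right ht.le hP1
    · rw [norm_smul, Real.norm_of_nonneg hε.le]
      exact mul_le_of_le_one_right hε.le hQ1
  refine ⟨h, fun u hu => le_trans (by positivity) (hcoer u hu), fun u hu hu1 => ?_⟩
  have hhu : ‖h u‖ = t := by
    rw [hh, Submodule.starProjection_eq_self_iff.2 hu, sub_self, smul_zero, add_zero, norm_smul,
      hu1, mul_one, Real.norm_of_nonneg ht.le]
  calc c0 / 4 * ρ ^ 2 * d m ^ 2 = c0 / 4 * (ρ * d m) ^ 2 := by ring
    _ ≤ c0 / 4 * ‖h u‖ ^ 2 := by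
      rw [hhu]
      gcongr
    _ ≤ I (h u) := hcoer u hu1.le
end
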